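/- Let s ≥ 0, b ∈ (0,1/2), σ ∈ (1/2,2/3) and β ∈ ℝ, and fix a cutoff ψ as in the context. Then there is a constant C > 0 such that for every Schwartz function φ : ℝ → ℂ one has sup_{t∈ℝ} ‖x ↦ ψ(t)·(S_β(t)φ)(x)‖_{H^s} + Σ_{j=0}^{2} sup_{x∈ℝ} ‖t ↦ ψ(t)·∂_x^j(S_β(t)φ)(x)‖_{H^{(s+1-j)/3}} + ‖(t,x) ↦ ψ(t)·(S_β(t)φ)(x)‖_{X^{s,b,β,σ}} ≤ C‖φ‖_{H^s}. -/

import Mathlib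

open MeasureTheory

/-- One-dimensional Fourier transform: `f̂(ξ) = ∫ e^{-iξx} f(x) dx`. -/
noncomputable def FT1 (f : ℝ → ℂ) (ξ : ℝ) : ℂ :=
  ∫ x : ℝ, Complex.exp (-(Complex.I * ξ * x)) * f x

/-- Two-dimensional Fourier transform: `F̂(τ,ξ) = ∬ e^{-i(tτ+xξ)} F(t,x) dt dx`. -/
noncomputable def FT2 (F : ℝ × ℝ → ℂ) (τ ξ : ℝ) : ℂ :=
  ∫ q : ℝ × ℝ, Complex.exp (-(Complex.I * (q.1 * τ + q.2 * ξ))) * F q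

/-- Sobolev norm `‖g‖_{H^r}² = (1/2π)∫ (1+|λ|)^{2r} |ĝ(λ)|² dλ`. -/
noncomputable def sobNorm (r : ℝ) (g : ℝ → ℂ) : ℝ :=
  Real.sqrt ((1 / (2 * Real.pi)) * ∫ l : ℝ, (1 + |l|) ^ (2 * r) * ‖FT1 g l‖ ^ 2)

/-- Airy group `(S_β(t)φ)(x) = (1/2π)∫ e^{iξx+it(ξ³-βξ)} φ̂(ξ) dξ`. -/
noncomputable def airy (β t : ℝ) (φ : ℝ → ℂ) (x : ℝ) : ℂ :=
  (1 / (2 * (Real.pi : ℂ))) * ∫ ξ : ℝ,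
    Complex.exp (Complex.I * ξ * x + Complex.I * t * ((ξ : ℂ)^3 - β * ξ)) * FT1 φ ξ

/-- The weight `ν(τ,ξ) = (1+|τ-ξ³+βξ|)^b + χ_{[-1,1]}(ξ)(1+|τ|)^σ`. -/
noncomputable def nuWt (b σ β τ ξ : ℝ) : ℝ :=
  (1 + |τ - ξ^3 + β * ξ|) ^ b +
    Set.indicator (Set.Icc (-1:ℝ) 1) (fun _ => (1:ℝ)) ξ * (1 + |τ|) ^ σ

/-- The Bourgain norm `‖F‖_{X^{s,b,β,σ}}`, where `F = F(t,x)`. -/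
noncomputable def XNorm (s b β σ : ℝ) (F : ℝ × ℝ → ℂ) : ℝ :=
  Real.sqrt (∫ q : ℝ × ℝ,
    (1 + |q.2| + |q.1| ^ ((1:ℝ)/3)) ^ (2 * s) * (nuWt b σ β q.1 q.2)^2 * ‖FT2 F q.1 q.2‖^2)

open scoped FourierTransform ENNReal

theorem FT1_eq_fourier (f : ℝ → ℂ) (ξ : ℝ) : FT1 f ξ = 𝓕 f (ξ / (2 * Real.pi)) := by
  rw [Real.fourier_eq']
  unfold FT1
  congr 1
  ext x
  rw [smul_eq_mul]
  congr 2
  have : (Real.pi : ℂ) ≠ 0 := by exact_mod_cast Real.pi_ne_zero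
  simp
  field_simp

theorem FT1_decay (f : SchwartzMap ℝ ℂ) (n : ℕ) :
    ∃ C, 0 < C ∧ ∀ ξ : ℝ, (1 + |ξ|) ^ n * ‖FT1 f ξ‖ ≤ C := by
  have hp : (0:ℝ) < 2 * Real.pi := by positivity
  have h1 : (1:ℝ) ≤ 2 * Real.pi := by linarith [Real.pi_gt_three]
  refine ⟨(2 * Real.pi) ^ n * (2 ^ n *
    (Finset.Iic ((n, 0) : ℕ × ℕ)).sup (fun m => SchwartzMap.seminorm ℝ m.1 m.2) (𝓕 f)) + 1,
    by positivity, fun ξ => ?_⟩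
  have h := SchwartzMap.one_add_le_sup_seminorm_apply (𝕜 := ℝ) (m := (n, 0)) (k := n) (n := 0)
    le_rfl le_rfl (𝓕 f) (ξ / (2 * Real.pi))
  rw [norm_iteratedFDeriv_zero, SchwartzMap.fourier_coe, ← FT1_eq_fourier] at h
  have h2 : (1 + |ξ|) ≤ (2 * Real.pi) * (1 + ‖ξ / (2 * Real.pi)‖) := by
    rw [Real.norm_eq_abs, abs_div, abs_of_pos hp, mul_add, mul_div_cancel₀ _ hp.ne']
    linarith
  calc (1 + |ξ|) ^ n * ‖FT1 f ξ‖ ≤ ((2 * Real.pi) * (1 + ‖ξ / (2 * Real.pi)‖)) ^ n * ‖FT1 f ξ‖ := by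
        gcongr
    _ = (2 * Real.pi) ^ n * ((1 + ‖ξ / (2 * Real.pi)‖) ^ n * ‖FT1 f ξ‖) := by rw [mul_pow]; ring
    _ ≤ (2 * Real.pi) ^ n * (2 ^ n *
    (Finset.Iic ((n, 0) : ℕ × ℕ)).sup (fun m => SchwartzMap.seminorm ℝ m.1 m.2) (𝓕 f)) := by gcongr
    _ ≤ _ := by linarith

theorem FT1_continuous (f : SchwartzMap ℝ ℂ) : Continuous (FT1 f) := by
  have : FT1 f = fun ξ => (𝓕 f) (ξ / (2 * Real.pi)) := by
    ext ξ
    rw [FT1_eq_fourier, SchwartzMap.fourier_coe]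
  rw [this]
  exact (𝓕 f).continuous.comp (by fun_prop)

/-- real-power decay with a quadratic gain -/
theorem FT1_decay_rpow (f : SchwartzMap ℝ ℂ) (r : ℝ) :
    ∃ C, 0 < C ∧ ∀ ξ : ℝ, (1 + |ξ|) ^ r * ‖FT1 f ξ‖ ≤ C * (1 + ξ ^ 2)⁻¹ := by
  obtain ⟨n, hn⟩ := exists_nat_ge (r + 2)
  obtain ⟨C, hC, h⟩ := FT1_decay f n
  refine ⟨C, hC, fun ξ => ?_⟩
  have hx : 1 ≤ 1 + |ξ| := by linarith [abs_nonneg ξ]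
  rw [← div_eq_mul_inv, le_div_iff₀ (by positivity)]
  refine le_trans ?_ (h ξ)
  have h3 : (1 + ξ ^ 2) ≤ (1 + |ξ|) ^ (2:ℝ) := by
    rw [Real.rpow_two]; nlinarith [abs_nonneg ξ, sq_abs ξ]
  calc (1 + |ξ|) ^ r * ‖FT1 f ξ‖ * (1 + ξ ^ 2)
      ≤ (1 + |ξ|) ^ r * ‖FT1 f ξ‖ * (1 + |ξ|) ^ (2:ℝ) := by gcongr
    _ = (1 + |ξ|) ^ (r + 2) * ‖FT1 f ξ‖ := by rw [Real.rpow_add (by linarith)]; ring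
    _ ≤ (1 + |ξ|) ^ (n:ℝ) * ‖FT1 f ξ‖ := by
        gcongr
    _ = _ := by rw [Real.rpow_natCast]

theorem cont_wt (r : ℝ) : Continuous fun ξ : ℝ => (1 + |ξ|) ^ r :=
  Continuous.rpow_const (by fun_prop) fun x => Or.inl (by positivity)

theorem FT1_integrable_rpow (f : SchwartzMap ℝ ℂ) (r : ℝ) :
    Integrable fun ξ : ℝ => (1 + |ξ|) ^ r * ‖FT1 f ξ‖ := by
  obtain ⟨C, hC, h⟩ := FT1_decay_rpow f r
  refine (integrable_inv_one_add_sq.const_mul C).mono'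
    ((cont_wt r).mul (FT1_continuous f).norm).aestronglyMeasurable (ae_of_all _ fun ξ => ?_)
  rw [Real.norm_of_nonneg (by positivity)]
  exact h ξ

theorem FT1_integrable_sq (f : SchwartzMap ℝ ℂ) (r : ℝ) :
    Integrable fun ξ : ℝ => (1 + |ξ|) ^ (2 * r) * ‖FT1 f ξ‖ ^ 2 := by
  obtain ⟨C, hC, h⟩ := FT1_decay f 0
  refine ((FT1_integrable_rpow f (2 * r)).const_mul C).mono'
    ((cont_wt _).mul ((FT1_continuous f).norm.pow 2)).aestronglyMeasurable
    (ae_of_all _ fun ξ => ?_)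
  rw [Real.norm_of_nonneg (by positivity)]
  have := h ξ
  rw [pow_zero, one_mul] at this
  calc (1 + |ξ|) ^ (2 * r) * ‖FT1 f ξ‖ ^ 2 = ‖FT1 f ξ‖ * ((1 + |ξ|) ^ (2 * r) * ‖FT1 f ξ‖) := by ring
    _ ≤ _ := by gcongr

/-- Fourier inversion in our normalization. -/
theorem FT1_inv (h : ℝ → ℂ) (hc : Continuous h) (hi : Integrable h)
    (hk : Integrable fun x : ℝ => (1 / (2 * (Real.pi : ℂ))) *
      ∫ ξ : ℝ, Complex.exp (Complex.I * ξ * x) * h ξ) (ξ : ℝ) :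
    FT1 (fun x : ℝ => (1 / (2 * (Real.pi : ℂ))) *
      ∫ ξ : ℝ, Complex.exp (Complex.I * ξ * x) * h ξ) ξ = h ξ := by
  have hp : (0:ℝ) < 2 * Real.pi := by positivity
  have hpc : (Real.pi : ℂ) ≠ 0 := by exact_mod_cast Real.pi_ne_zero
  have key : (fun x : ℝ => (1 / (2 * (Real.pi : ℂ))) *
      ∫ ξ : ℝ, Complex.exp (Complex.I * ξ * x) * h ξ) =
      fun x : ℝ => (1 / (2 * (Real.pi : ℂ))) * 𝓕⁻ h (x / (2 * Real.pi)) := by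
    ext x
    rw [Real.fourierInv_eq']
    congr 2
    ext y
    rw [smul_eq_mul]
    congr 2
    simp
    field_simp
  rw [key] at hk ⊢
  have h2 : Integrable (𝓕⁻ h) := by
    have h3 := (hk.const_mul (2 * (Real.pi : ℂ))).comp_mul_right' hp.ne'
    refine h3.congr (ae_of_all _ fun y => ?_)
    simp only
    rw [mul_div_assoc, div_self hp.ne', mul_one]
    field_simp
  have h4 := hc.fourier_fourierInv_eq hi (f := h)
  have h5 := fun hfi => h4 hfi
  have hF : Integrable (𝓕 h) := by
    have := h2.comp_neg
    refine this.congr (ae_of_all _ fun y => ?_)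
    simp only
    rw [Real.fourierInv_eq_fourier_neg, neg_neg]
  have h6 := congrFun (h4 hF) ξ
  rw [← h6, Real.fourier_eq']
  unfold FT1
  have h7 := Measure.integral_comp_div (fun y : ℝ => Complex.exp (-(Complex.I * ξ * (2 * Real.pi * y))) *
    ((1 / (2 * (Real.pi : ℂ))) * 𝓕⁻ h y)) (2 * Real.pi)
  have h8 : (∫ x : ℝ, Complex.exp (-(Complex.I * ξ * x)) *
      ((1 / (2 * (Real.pi : ℂ))) * 𝓕⁻ h (x / (2 * Real.pi)))) =
      ∫ x : ℝ, (fun y : ℝ => Complex.exp (-(Complex.I * ξ * (2 * Real.pi * y))) *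
    ((1 / (2 * (Real.pi : ℂ))) * 𝓕⁻ h y)) (x / (2 * Real.pi)) := by
    congr 1
    ext x
    simp only
    congr 3
    push_cast
    field_simp
  rw [h8, h7, abs_of_pos hp, ← integral_smul]
  congr 1
  ext y
  simp only [Complex.real_smul, smul_eq_mul]
  have h9 : Complex.exp (-(Complex.I * ξ * (2 * Real.pi * y))) =
    Complex.exp (↑(-2 * Real.pi * inner ℝ y ξ) * Complex.I) := by
    congr 1
    simp
    ring
  rw [h9]
  push_cast
  field_simp

theorem integral_le_of_lintegral {α : Type*} [MeasurableSpace α] {μ : Measure α} (f : α → ℝ)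
    (hf : ∀ x, 0 ≤ f x) {A : ℝ}
    (hA : 0 ≤ A) (h : ∫⁻ x, ENNReal.ofReal (f x) ∂μ ≤ ENNReal.ofReal A) : ∫ x, f x ∂μ ≤ A := by
  by_cases hm : AEStronglyMeasurable f μ
  · rw [integral_eq_lintegral_of_nonneg_ae (ae_of_all _ hf) hm]
    exact ENNReal.toReal_le_of_le_ofReal hA h
  · rw [integral_undef (fun h => hm h.1)]
    exact hA

/-- the dispersion relation -/
noncomputable def om (β ξ : ℝ) : ℝ := ξ ^ 3 - β * ξ

theorem om_cont (β : ℝ) : Continuous (om β) := by unfold om; fun_prop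

theorem om_up (β ξ : ℝ) : 1 + |om β ξ| ≤ 8 * (1 + |β|) ^ 3 * (1 + |ξ|) ^ 3 := by
  have h1 : |om β ξ| ≤ |ξ| ^ 3 + |β| * |ξ| := by
    unfold om
    calc |ξ ^ 3 - β * ξ| ≤ |ξ ^ 3| + |β * ξ| := abs_sub _ _
      _ = _ := by rw [abs_pow, abs_mul]
  have hb := abs_nonneg β
  have hx := abs_nonneg ξ
  generalize |β| = B at *
  generalize |ξ| = x at *
  have h2 : 1 + (x ^ 3 + B * x) ≤ (1 + B) * (1 + x) ^ 3 := by
    have : 0 ≤ B * (1 + 2 * x + 3 * x ^ 2 + x ^ 3) + 3 * x + 3 * x ^ 2 := by positivity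
    nlinarith
  have h3 : (1 + B) ≤ 8 * (1 + B) ^ 3 := by
    have : 0 ≤ 7 + 23 * B + 24 * B ^ 2 + 8 * B ^ 3 := by positivity
    nlinarith
  have h4 : (1 + B) * (1 + x) ^ 3 ≤ 8 * (1 + B) ^ 3 * (1 + x) ^ 3 := by gcongr
  linarith

theorem om_low (β ξ : ℝ) : (1 + |ξ|) ^ 3 ≤ 8 * (1 + |β|) ^ 3 * (1 + |om β ξ|) := by
  have h1 : |ξ| ^ 3 ≤ |om β ξ| + |β| * |ξ| := by
    calc |ξ| ^ 3 = |om β ξ + β * ξ| := by unfold om; rw [← abs_pow]; congr 1; ring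
      _ ≤ |om β ξ| + |β * ξ| := abs_add_le _ _
      _ = _ := by rw [abs_mul]
  have hb := abs_nonneg β
  have hx := abs_nonneg ξ
  have ho := abs_nonneg (om β ξ)
  generalize |β| = B at *
  generalize |ξ| = x at *
  generalize |om β ξ| = w at *
  have h3 : 1 ≤ (1 + B) ^ 3 := one_le_pow₀ (by linarith)
  by_cases hc : 2 * B ≤ x ^ 2
  · have h4 : x ^ 3 ≤ 2 * w := by nlinarith
    have h5 : (1 + x) ^ 3 ≤ 4 * (1 + x ^ 3) := by
      nlinarith [mul_nonneg (by linarith : 0 ≤ 1 + x) (sq_nonneg (x - 1))]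
    have h6 : 8 * 1 * (1 + w) ≤ 8 * (1 + B) ^ 3 * (1 + w) := by gcongr
    linarith
  · have h4 : x ≤ 1 + 2 * B := by nlinarith
    have h5 : (1 + x) ^ 3 ≤ (2 + 2 * B) ^ 3 :=
      pow_le_pow_left₀ (by linarith) (by linarith) 3
    have h6 : 8 * (1 + B) ^ 3 * 1 ≤ 8 * (1 + B) ^ 3 * (1 + w) := by gcongr; linarith
    nlinarith

theorem peetre (a b : ℝ) : 1 + |a| ≤ (1 + |a - b|) * (1 + |b|) := by
  have : |a| ≤ |a - b| + |b| := by
    calc |a| = |(a - b) + b| := by ring_nf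
      _ ≤ _ := abs_add_le _ _
  nlinarith [abs_nonneg (a - b), abs_nonneg b, mul_nonneg (abs_nonneg (a - b)) (abs_nonneg b)]

theorem wt_bound (β a l ξ : ℝ) : (1 + |l|) ^ a ≤
    (8 * (1 + |β|) ^ 3) ^ |a| * (1 + |l - om β ξ|) ^ |a| * (1 + |ξ|) ^ (3 * a) := by
  have hB : (0:ℝ) < 8 * (1 + |β|) ^ 3 := by positivity
  have hx3 : (1 + |ξ|) ^ (3 * a) = ((1 + |ξ|) ^ 3) ^ a := by
    rw [Real.rpow_mul (by positivity)]; norm_num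
  rw [hx3, ← Real.mul_rpow (by positivity) (by positivity)]
  rcases le_total 0 a with ha | ha
  · rw [abs_of_nonneg ha, ← Real.mul_rpow (by positivity) (by positivity)]
    refine Real.rpow_le_rpow (by positivity) ?_ ha
    calc 1 + |l| ≤ (1 + |l - om β ξ|) * (1 + |om β ξ|) := peetre _ _
      _ ≤ (1 + |l - om β ξ|) * (8 * (1 + |β|) ^ 3 * (1 + |ξ|) ^ 3) := by
        gcongr; exact om_up β ξ
      _ = _ := by ring
  · rw [abs_of_nonpos ha, Real.rpow_neg (by positivity), ← Real.inv_rpow (by positivity),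
      ← Real.mul_rpow (by positivity) (by positivity)]
    refine Real.rpow_le_rpow_of_nonpos (by positivity) ?_ ha
    rw [inv_mul_le_iff₀ (by positivity)]
    calc (1 + |ξ|) ^ 3 ≤ 8 * (1 + |β|) ^ 3 * (1 + |om β ξ|) := om_low β ξ
      _ ≤ 8 * (1 + |β|) ^ 3 * ((1 + |om β ξ - l|) * (1 + |l|)) := by
        gcongr; exact peetre _ _
      _ = _ := by rw [abs_sub_comm]; ring

theorem lint_J : ∫⁻ x : ℝ, ENNReal.ofReal ((1 + x ^ 2)⁻¹) = ENNReal.ofReal Real.pi := by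
  rw [← ofReal_integral_eq_lintegral_ofReal integrable_inv_one_add_sq
    (ae_of_all _ fun x => by positivity), integral_univ_inv_one_add_sq]

theorem cov_half (β l : ℝ) (S : Set ℝ) (hS : MeasurableSet S)
    (hd : ∀ x ∈ S, (1 + |x|) ^ 2 ≤ 2 * (3 * x ^ 2 - β)) (hinj : Set.InjOn (om β) S) :
    ∫⁻ ξ in S, ENNReal.ofReal ((1 + |ξ|) ^ 2 * (1 + (l - om β ξ) ^ 2)⁻¹)
      ≤ ENNReal.ofReal (2 * Real.pi) := by
  have hder : ∀ x ∈ S, HasDerivWithinAt (om β) (3 * x ^ 2 - β) S x := by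
    intro x _
    have h : HasDerivAt (fun x : ℝ => x ^ 3 - β * x) (3 * x ^ 2 - β) x := by
      simpa using (hasDerivAt_pow 3 x).fun_sub ((hasDerivAt_id' x).const_mul β)
    exact h.hasDerivWithinAt
  have h1 := lintegral_image_eq_lintegral_abs_deriv_mul hS hder hinj
    (fun m => ENNReal.ofReal ((1 + (l - m) ^ 2)⁻¹))
  calc ∫⁻ ξ in S, ENNReal.ofReal ((1 + |ξ|) ^ 2 * (1 + (l - om β ξ) ^ 2)⁻¹)
      ≤ ∫⁻ ξ in S, ENNReal.ofReal 2 * (ENNReal.ofReal |3 * ξ ^ 2 - β| *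
          ENNReal.ofReal ((1 + (l - om β ξ) ^ 2)⁻¹)) := by
        refine setLIntegral_mono' hS fun x hx => ?_
        rw [← ENNReal.ofReal_mul (by positivity), ← ENNReal.ofReal_mul (by positivity)]
        apply ENNReal.ofReal_le_ofReal
        have := hd x hx
        rw [← mul_assoc]
        gcongr
        exact this.trans (by gcongr; exact le_abs_self _)
    _ = ENNReal.ofReal 2 * ∫⁻ m in om β '' S, ENNReal.ofReal ((1 + (l - m) ^ 2)⁻¹) := by
        rw [lintegral_const_mul' _ _ ENNReal.ofReal_ne_top, h1]
    _ ≤ ENNReal.ofReal 2 * ∫⁻ m, ENNReal.ofReal ((1 + (l - m) ^ 2)⁻¹) := by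
        gcongr; exact Measure.restrict_le_self
    _ = ENNReal.ofReal 2 * ∫⁻ m : ℝ, ENNReal.ofReal ((1 + m ^ 2)⁻¹) := by
        rw [lintegral_sub_left_eq_self (fun m => ENNReal.ofReal ((1 + m ^ 2)⁻¹)) l]
    _ = _ := by rw [lint_J, ← ENNReal.ofReal_mul (by positivity)]

theorem cov (β : ℝ) : ∃ K : ℝ, 0 < K ∧ ∀ l : ℝ,
    ∫⁻ ξ : ℝ, ENNReal.ofReal ((1 + |ξ|) ^ 2 * (1 + (l - om β ξ) ^ 2)⁻¹) ≤ ENNReal.ofReal K := by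
  set R := 1 + |β| with hR
  have hb := abs_nonneg β
  have hb2 := le_abs_self β
  have hRp : 1 ≤ R := by linarith
  refine ⟨(1 + R) ^ 2 * (2 * R) + 2 * Real.pi + 2 * Real.pi, by positivity, fun l => ?_⟩
  have hun : (Set.univ : Set ℝ) ⊆ (Set.Icc (-R) R ∪ Set.Ioi R) ∪ Set.Iio (-R) := by
    intro x _
    simp only [Set.mem_union, Set.mem_Icc, Set.mem_Ioi, Set.mem_Iio]
    grind
  rw [← setLIntegral_univ]
  refine (lintegral_mono_set hun).trans ?_
  refine (lintegral_union_le _ _ _).trans ?_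
  rw [ENNReal.ofReal_add (by positivity) (by positivity)]
  have hd : ∀ x : ℝ, R < |x| → (1 + |x|) ^ 2 ≤ 2 * (3 * x ^ 2 - β) := by
    intro x hx
    rw [← sq_abs x]
    nlinarith
  refine add_le_add ((lintegral_union_le _ _ _).trans ?_) ?_
  · rw [ENNReal.ofReal_add (by positivity) (by positivity)]
    refine add_le_add ?_ ?_
    · calc ∫⁻ ξ in Set.Icc (-R) R, ENNReal.ofReal ((1 + |ξ|) ^ 2 * (1 + (l - om β ξ) ^ 2)⁻¹)
          ≤ ∫⁻ ξ in Set.Icc (-R) R, ENNReal.ofReal ((1 + R) ^ 2) := by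
            refine setLIntegral_mono' measurableSet_Icc fun x hx => ?_
            apply ENNReal.ofReal_le_ofReal
            have h1 : |x| ≤ R := abs_le.2 hx
            calc (1 + |x|) ^ 2 * (1 + (l - om β x) ^ 2)⁻¹ ≤ (1 + R) ^ 2 * 1 := by
                  gcongr
                  exact inv_le_one_of_one_le₀ (by nlinarith [sq_nonneg (l - om β x)])
              _ = _ := by ring
        _ = _ := by
            rw [setLIntegral_const, Real.volume_Icc, ← ENNReal.ofReal_mul (by positivity)]
            congr 2; ring
    · refine cov_half β l _ measurableSet_Ioi (fun x hx => hd x ?_) ?_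
      · exact lt_of_lt_of_le hx (le_abs_self x)
      · intro x hx y hy hxy
        simp only [Set.mem_Ioi] at hx hy
        unfold om at hxy
        have h1 : (x - y) * (x ^ 2 + x * y + y ^ 2 - β) = 0 := by linarith
        rcases mul_eq_zero.1 h1 with h | h
        · linarith
        · nlinarith
  · refine cov_half β l _ measurableSet_Iio (fun x hx => hd x ?_) ?_
    · simp only [Set.mem_Iio] at hx
      exact lt_of_lt_of_le (by linarith) (neg_le_abs x)
    · intro x hx y hy hxy
      simp only [Set.mem_Iio] at hx hy
      unfold om at hxy
      have h1 : (x - y) * (x ^ 2 + x * y + y ^ 2 - β) = 0 := by linarith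
      rcases mul_eq_zero.1 h1 with h | h
      · linarith
      · nlinarith

theorem lintegral_cs (f g : ℝ → ℝ≥0∞) (hf : AEMeasurable f) (hg : AEMeasurable g) :
    (∫⁻ x, f x * g x) ^ 2 ≤ (∫⁻ x, f x ^ 2) * ∫⁻ x, g x ^ 2 := by
  have h := ENNReal.lintegral_mul_le_Lp_mul_Lq volume Real.HolderConjugate.two_two hf hg
  have h2 := pow_le_pow_left' h 2
  refine h2.trans (le_of_eq ?_)
  rw [mul_pow, ← ENNReal.rpow_natCast, ← ENNReal.rpow_natCast, ← ENNReal.rpow_mul,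
    ← ENNReal.rpow_mul]
  norm_num

theorem schur (β : ℝ) : ∃ K : ℝ, 0 < K ∧ ∀ G F : ℝ → ℝ, Continuous G → (∀ ξ, 0 ≤ G ξ) →
    (∀ l, 0 ≤ F l) → Integrable (fun ξ => G ξ ^ 2) →
    (∀ l, ENNReal.ofReal (F l) ≤
      ∫⁻ ξ, ENNReal.ofReal ((1 + |ξ|) * (1 + (l - om β ξ) ^ 2)⁻¹ * G ξ)) →
    ∫ l, F l ^ 2 ≤ K * ∫ ξ, G ξ ^ 2 := by
  obtain ⟨K, hK, hcov⟩ := cov β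
  refine ⟨K * Real.pi, by positivity, fun G F hG hG0 hF0 hGi hFG => ?_⟩
  have hE : 0 ≤ ∫ ξ, G ξ ^ 2 := integral_nonneg fun _ => by positivity
  have hom := om_cont β
  have hpos : ∀ l ξ, (1 + (l - om β ξ) ^ 2) ≠ 0 := fun l ξ => by positivity
  refine integral_le_of_lintegral _ (fun _ => by positivity) (by positivity) ?_
  have step : ∀ l, ENNReal.ofReal (F l ^ 2) ≤ ENNReal.ofReal K *
      ∫⁻ ξ, ENNReal.ofReal ((1 + (l - om β ξ) ^ 2)⁻¹ * G ξ ^ 2) := by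
    intro l
    rw [ENNReal.ofReal_pow (hF0 l)]
    refine (pow_le_pow_left' (hFG l) 2).trans ?_
    have hJc : Continuous fun ξ => (1 + (l - om β ξ) ^ 2)⁻¹ :=
      Continuous.inv₀ (by fun_prop) (hpos l)
    have h1 := lintegral_cs
      (fun ξ => ENNReal.ofReal ((1 + |ξ|) * Real.sqrt ((1 + (l - om β ξ) ^ 2)⁻¹)))
      (fun ξ => ENNReal.ofReal (Real.sqrt ((1 + (l - om β ξ) ^ 2)⁻¹) * G ξ))
      (by apply Measurable.aemeasurable; apply ENNReal.measurable_ofReal.comp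
          exact Continuous.measurable (by fun_prop))
      (by apply Measurable.aemeasurable; apply ENNReal.measurable_ofReal.comp
          exact Continuous.measurable (by fun_prop))
    refine le_trans (le_of_eq ?_) (h1.trans ?_)
    · congr 2
      ext ξ
      rw [← ENNReal.ofReal_mul (by positivity)]
      congr 1
      have := Real.mul_self_sqrt (show 0 ≤ (1 + (l - om β ξ) ^ 2)⁻¹ by positivity)
      conv_lhs => rw [← this]
      ring
    · refine mul_le_mul' (le_trans (le_of_eq ?_) (hcov l)) (le_of_eq ?_)
      · congr 1
        ext ξ
        rw [← ENNReal.ofReal_pow (by positivity), mul_pow, Real.sq_sqrt (by positivity)]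
      · congr 1
        ext ξ
        rw [← ENNReal.ofReal_pow (mul_nonneg (by positivity) (hG0 ξ)), mul_pow,
          Real.sq_sqrt (by positivity)]
  have hJ2 : Continuous fun p : ℝ × ℝ => (1 + (p.1 - om β p.2) ^ 2)⁻¹ :=
      Continuous.inv₀ (by fun_prop) (fun p => hpos p.1 p.2)
  calc ∫⁻ l, ENNReal.ofReal (F l ^ 2)
      ≤ ∫⁻ l, ENNReal.ofReal K *
        ∫⁻ ξ, ENNReal.ofReal ((1 + (l - om β ξ) ^ 2)⁻¹ * G ξ ^ 2) := lintegral_mono step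
    _ = ENNReal.ofReal K *
        ∫⁻ l, ∫⁻ ξ, ENNReal.ofReal ((1 + (l - om β ξ) ^ 2)⁻¹ * G ξ ^ 2) :=
        lintegral_const_mul' _ _ ENNReal.ofReal_ne_top
    _ = ENNReal.ofReal K *
        ∫⁻ ξ, ∫⁻ l, ENNReal.ofReal ((1 + (l - om β ξ) ^ 2)⁻¹ * G ξ ^ 2) := by
        rw [lintegral_lintegral_swap]
        apply Measurable.aemeasurable; apply ENNReal.measurable_ofReal.comp
        exact Continuous.measurable (by fun_prop)
    _ = ENNReal.ofReal K * ∫⁻ ξ, ENNReal.ofReal Real.pi * ENNReal.ofReal (G ξ ^ 2) := by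
        congr 2
        ext ξ
        simp_rw [ENNReal.ofReal_mul (inv_nonneg.2 (add_nonneg zero_le_one (sq_nonneg _)))]
        rw [lintegral_mul_const' _ _ ENNReal.ofReal_ne_top,
          lintegral_sub_right_eq_self (fun m : ℝ => ENNReal.ofReal ((1 + m ^ 2)⁻¹)) (om β ξ), lint_J]
    _ = ENNReal.ofReal (K * Real.pi * ∫ ξ, G ξ ^ 2) := by
        rw [lintegral_const_mul' _ _ ENNReal.ofReal_ne_top,
          ← ofReal_integral_eq_lintegral_ofReal hGi (ae_of_all _ fun _ => by positivity),
          ← ENNReal.ofReal_mul (by positivity), ← ENNReal.ofReal_mul (by positivity), mul_assoc]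

theorem exp_norm (β t x ξ : ℝ) :
    ‖Complex.exp (Complex.I * ξ * x + Complex.I * t * ((ξ : ℂ)^3 - β * ξ))‖ = 1 := by
  have : Complex.I * ξ * x + Complex.I * t * ((ξ : ℂ)^3 - β * ξ) =
      ((ξ * x + t * (ξ ^ 3 - β * ξ) : ℝ) : ℂ) * Complex.I := by push_cast; ring
  rw [this, Complex.norm_exp_ofReal_mul_I]

theorem exp_norm' (β t ξ : ℝ) :
    ‖Complex.exp (Complex.I * t * ((ξ : ℂ)^3 - β * ξ))‖ = 1 := by
  have := exp_norm β t 0 ξ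
  simpa using this

theorem exp_norm'' (a b : ℝ) :
    ‖Complex.exp (-(Complex.I * a * b))‖ = 1 := by
  have : -(Complex.I * a * b) = ((-(a * b) : ℝ) : ℂ) * Complex.I := by push_cast; ring
  rw [this, Complex.norm_exp_ofReal_mul_I]

theorem FT1_int (f : SchwartzMap ℝ ℂ) : Integrable (FT1 f) := by
  have := FT1_integrable_rpow f 0
  simp only [Real.rpow_zero, one_mul] at this
  exact (integrable_norm_iff (FT1_continuous f).aestronglyMeasurable).1 this

theorem airy_FT (β t : ℝ) (φ : SchwartzMap ℝ ℂ) (hi : Integrable (airy β t φ)) (ξ : ℝ) :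
    FT1 (airy β t φ) ξ = Complex.exp (Complex.I * t * ((ξ : ℂ)^3 - β * ξ)) * FT1 φ ξ := by
  have key : airy β t φ = fun x : ℝ => (1 / (2 * (Real.pi : ℂ))) *
      ∫ ξ : ℝ, Complex.exp (Complex.I * ξ * x) *
        ((fun ξ : ℝ => Complex.exp (Complex.I * t * ((ξ : ℂ)^3 - β * ξ)) * FT1 φ ξ) ξ) := by
    ext x
    unfold airy
    congr 2
    ext ξ
    rw [Complex.exp_add]
    ring
  have hcg := FT1_continuous φ
  have hc : Continuous fun ξ : ℝ =>
      Complex.exp (Complex.I * t * ((ξ : ℂ)^3 - β * ξ)) * FT1 φ ξ := by fun_prop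
  rw [key] at hi ⊢
  refine FT1_inv _ hc ?_ hi ξ
  refine (FT1_int φ).norm.mono' hc.aestronglyMeasurable (ae_of_all _ fun ξ => ?_)
  rw [norm_mul, exp_norm', one_mul]

theorem FT1_undef (f : ℝ → ℂ) (hf : ¬ Integrable f) (ξ : ℝ) : FT1 f ξ = 0 := by
  unfold FT1
  refine integral_undef fun h => hf ?_
  have hc : Continuous fun x : ℝ => Complex.exp (Complex.I * ξ * x) := by fun_prop
  have h2 := h.bdd_mul (c := 1) hc.aestronglyMeasurable (ae_of_all _ fun x => by
    have := exp_norm'' (-ξ) x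
    simp only [Complex.ofReal_neg, mul_neg, neg_mul, neg_neg] at this
    exact this.le)
  refine h2.congr (ae_of_all _ fun x => ?_)
  simp only
  rw [← mul_assoc, ← Complex.exp_add]
  simp

theorem FT1_const_mul (c : ℂ) (f : ℝ → ℂ) (ξ : ℝ) : FT1 (fun x => c * f x) ξ = c * FT1 f ξ := by
  unfold FT1
  rw [← integral_const_mul]
  congr 1
  ext x
  ring

theorem sobNorm_nonneg (r : ℝ) (g : ℝ → ℂ) : 0 ≤ sobNorm r g := Real.sqrt_nonneg _

theorem sobNorm_le_of {r s K : ℝ} (hK : 0 ≤ K) (f : ℝ → ℂ) (g : ℝ → ℂ)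
    (h : ∫ l : ℝ, (1 + |l|) ^ (2 * r) * ‖FT1 f l‖ ^ 2 ≤
      K * ∫ l : ℝ, (1 + |l|) ^ (2 * s) * ‖FT1 g l‖ ^ 2) :
    sobNorm r f ≤ Real.sqrt K * sobNorm s g := by
  unfold sobNorm
  rw [← Real.sqrt_mul hK]
  apply Real.sqrt_le_sqrt
  calc _ ≤ (1 / (2 * Real.pi)) * (K * ∫ l : ℝ, (1 + |l|) ^ (2 * s) * ‖FT1 g l‖ ^ 2) := by
        gcongr
    _ = _ := by ring

theorem part1 (s β M : ℝ) (ψ : ℝ → ℝ) (hM : ∀ t, |ψ t| ≤ M) (φ : SchwartzMap ℝ ℂ) (t : ℝ) :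
    sobNorm s (fun x => (ψ t : ℂ) * airy β t (⇑φ) x) ≤ Real.sqrt (M ^ 2) * sobNorm s φ := by
  have hM0 : 0 ≤ M := (abs_nonneg _).trans (hM 0)
  refine sobNorm_le_of (by positivity) _ _ ?_
  rw [← integral_const_mul]
  refine integral_mono_of_nonneg (ae_of_all _ fun _ => by positivity)
    ((FT1_integrable_sq φ s).const_mul _) (ae_of_all _ fun ξ => ?_)
  simp only
  have h1 : ‖FT1 (airy β t φ) ξ‖ ≤ ‖FT1 φ ξ‖ := by
    by_cases hi : Integrable (airy β t φ)
    · rw [airy_FT β t φ hi, norm_mul, exp_norm', one_mul]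
    · rw [FT1_undef _ hi, norm_zero]; positivity
  rw [FT1_const_mul, norm_mul, Complex.norm_real, Real.norm_eq_abs]
  calc (1 + |ξ|) ^ (2 * s) * (|ψ t| * ‖FT1 (airy β t φ) ξ‖) ^ 2
      ≤ (1 + |ξ|) ^ (2 * s) * (M * ‖FT1 φ ξ‖) ^ 2 := by gcongr; exact hM t
    _ = _ := by ring

/-- differentiation under the integral sign -/
theorem deriv_osc (β t : ℝ) (h : ℝ → ℂ) (hc : Continuous h) (hi : Integrable h)
    (hi2 : Integrable fun ξ : ℝ => (Complex.I * ξ) * h ξ) (x : ℝ) :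
    HasDerivAt (fun y : ℝ => ∫ ξ : ℝ,
      Complex.exp (Complex.I * ξ * y + Complex.I * t * ((ξ : ℂ)^3 - β * ξ)) * h ξ)
      (∫ ξ : ℝ, Complex.exp (Complex.I * ξ * x + Complex.I * t * ((ξ : ℂ)^3 - β * ξ)) *
        ((Complex.I * ξ) * h ξ)) x := by
  refine (hasDerivAt_integral_of_dominated_loc_of_deriv_le (𝕜 := ℝ) (s := Set.univ)
    (bound := fun ξ => ‖(Complex.I * ξ) * h ξ‖)
    (F' := fun y ξ => Complex.exp (Complex.I * ξ * y + Complex.I * t * ((ξ : ℂ)^3 - β * ξ)) *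
        ((Complex.I * ξ) * h ξ)) Filter.univ_mem ?_ ?_ ?_ ?_ hi2.norm ?_).2
  · exact Filter.Eventually.of_forall fun y => Continuous.aestronglyMeasurable (by fun_prop)
  · refine hi.norm.mono' (Continuous.aestronglyMeasurable (by fun_prop)) (ae_of_all _ fun ξ => ?_)
    rw [norm_mul, exp_norm, one_mul]
  · exact Continuous.aestronglyMeasurable (by fun_prop)
  · refine ae_of_all _ fun ξ y _ => ?_
    rw [norm_mul, exp_norm, one_mul]
  · refine ae_of_all _ fun ξ y _ => ?_
    have h1 : HasDerivAt (fun z : ℝ => Complex.I * ξ * (z : ℂ) +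
        Complex.I * t * ((ξ : ℂ)^3 - β * ξ)) (Complex.I * ξ) y := by
      simpa using ((Complex.ofRealCLM.hasDerivAt (x := y)).const_mul (Complex.I * (ξ:ℂ))).add_const
        (Complex.I * t * ((ξ : ℂ)^3 - β * ξ))
    have h2 := h1.cexp.mul_const (h ξ)
    exact h2.congr_deriv (by ring)

theorem FT1_poly_int (φ : SchwartzMap ℝ ℂ) (j : ℕ) :
    Integrable fun ξ : ℝ => (Complex.I * ξ) ^ j * FT1 φ ξ := by
  have hcg := FT1_continuous φ
  refine (FT1_integrable_rpow φ j).mono' (Continuous.aestronglyMeasurable (by fun_prop))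
    (ae_of_all _ fun ξ => ?_)
  rw [norm_mul, norm_pow, norm_mul, Complex.norm_I, one_mul, Complex.norm_real, Real.norm_eq_abs,
    Real.rpow_natCast]
  gcongr
  linarith

theorem airy_deriv (β t : ℝ) (φ : SchwartzMap ℝ ℂ) (j : ℕ) :
    iteratedDeriv j (fun y => airy β t φ y) = fun x : ℝ => (1 / (2 * (Real.pi : ℂ))) * ∫ ξ : ℝ,
    Complex.exp (Complex.I * ξ * x + Complex.I * t * ((ξ : ℂ)^3 - β * ξ)) *
      ((Complex.I * ξ) ^ j * FT1 φ ξ) := by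
  have hcg := FT1_continuous φ
  induction j with
  | zero =>
    ext x
    simp [airy]
  | succ j ih =>
    rw [iteratedDeriv_succ, ih]
    ext x
    refine HasDerivAt.deriv ?_
    have h2 := FT1_poly_int φ (j + 1)
    have h := (deriv_osc β t (fun ξ => (Complex.I * ξ) ^ j * FT1 φ ξ) (by fun_prop)
      (FT1_poly_int φ j) (by simpa only [pow_succ', mul_assoc] using h2) x).const_mul
        (1 / (2 * (Real.pi : ℂ)))
    simpa only [pow_succ', mul_assoc] using h

theorem FT1_time (β x l : ℝ) (ψ : SchwartzMap ℝ ℂ) (φ : SchwartzMap ℝ ℂ) (j : ℕ) :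
    FT1 (fun t => ψ t * iteratedDeriv j (fun y => airy β t φ y) x) l =
    (1 / (2 * (Real.pi : ℂ))) * ∫ ξ : ℝ, Complex.exp (Complex.I * ξ * x) *
      ((Complex.I * ξ) ^ j * FT1 φ ξ) * FT1 ψ (l - om β ξ) := by
  have hcg := FT1_continuous φ
  have hcp := ψ.continuous
  simp_rw [airy_deriv]
  unfold FT1
  change (∫ t : ℝ, Complex.exp (-(Complex.I * l * t)) * (ψ t * ((1 / (2 * (Real.pi : ℂ))) * ∫ ξ : ℝ,
    Complex.exp (Complex.I * ξ * x + Complex.I * t * ((ξ : ℂ)^3 - β * ξ)) *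
      ((Complex.I * ξ) ^ j * FT1 φ ξ)))) = (1 / (2 * (Real.pi : ℂ))) *
      ∫ ξ : ℝ, Complex.exp (Complex.I * ξ * x) *
      ((Complex.I * ξ) ^ j * FT1 φ ξ) *
      ∫ t : ℝ, Complex.exp (-(Complex.I * ((l - om β ξ : ℝ) : ℂ) * t)) * ψ t
  have h1 : ∀ t : ℝ, Complex.exp (-(Complex.I * l * t)) * (ψ t * ((1 / (2 * (Real.pi : ℂ))) * ∫ ξ : ℝ,
    Complex.exp (Complex.I * ξ * x + Complex.I * t * ((ξ : ℂ)^3 - β * ξ)) *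
      ((Complex.I * ξ) ^ j * FT1 φ ξ))) = (1 / (2 * (Real.pi : ℂ))) * ∫ ξ : ℝ,
      (Complex.exp (-(Complex.I * l * t)) * ψ t) * (Complex.exp (Complex.I * ξ * x +
        Complex.I * t * ((ξ : ℂ)^3 - β * ξ)) * ((Complex.I * ξ) ^ j * FT1 φ ξ)) := by
    intro t
    rw [integral_const_mul]
    ring
  simp_rw [h1]
  rw [integral_const_mul, integral_integral_swap]
  · congr 2
    ext ξ
    rw [← integral_const_mul]
    congr 1
    ext t
    have h2 : Complex.exp (-(Complex.I * l * t)) * Complex.exp (Complex.I * ξ * x +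
        Complex.I * t * ((ξ : ℂ)^3 - β * ξ)) = Complex.exp (Complex.I * ξ * x) *
        Complex.exp (-(Complex.I * ((l - om β ξ : ℝ) : ℂ) * t)) := by
      rw [← Complex.exp_add, ← Complex.exp_add]
      congr 1
      unfold om
      push_cast
      ring
    linear_combination (ψ t * ((Complex.I * ξ) ^ j * FT1 φ ξ)) * h2
  · refine (ψ.integrable.norm.mul_prod (FT1_poly_int φ j).norm).mono'
      (Continuous.aestronglyMeasurable (by fun_prop)) (ae_of_all _ fun p => ?_)
    simp only [Function.uncurry]
    rw [norm_mul, norm_mul, exp_norm'', one_mul, norm_mul, exp_norm, one_mul]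

theorem part2 (s β : ℝ) (hs : 0 ≤ s) (ψ : SchwartzMap ℝ ℂ) (j : ℕ) :
    ∃ C, 0 ≤ C ∧ ∀ (φ : SchwartzMap ℝ ℂ) (x : ℝ),
      sobNorm ((s + 1 - j) / 3) (fun t => ψ t * iteratedDeriv j (fun y => airy β t (⇑φ) y) x)
        ≤ C * sobNorm s φ := by
  set a : ℝ := (s + 1 - j) / 3 with ha
  obtain ⟨D, hD, hdec⟩ := FT1_decay_rpow ψ |a|
  obtain ⟨K, hK, hschur⟩ := schur β
  set B : ℝ := (8 * (1 + |β|) ^ 3) ^ |a| with hB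
  have hB0 : 0 < B := by positivity
  refine ⟨Real.sqrt (K * (B * D) ^ 2), by positivity, fun φ x => ?_⟩
  refine sobNorm_le_of (by positivity) _ _ ?_
  have hcg := FT1_continuous φ
  have hcw := cont_wt s
  set f : ℝ → ℂ := fun t => ψ t * iteratedDeriv j (fun y => airy β t (⇑φ) y) x with hf
  have hG2 : ∀ ξ : ℝ, ((B * D) * ((1 + |ξ|) ^ s * ‖FT1 φ ξ‖)) ^ 2 =
      (B * D) ^ 2 * ((1 + |ξ|) ^ (2 * s) * ‖FT1 φ ξ‖ ^ 2) := by
    intro ξ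
    rw [mul_comm 2 s, Real.rpow_mul (by positivity), Real.rpow_two]
    ring
  have hF2 : ∀ l : ℝ, (1 + |l|) ^ (2 * a) * ‖FT1 f l‖ ^ 2 = ((1 + |l|) ^ a * ‖FT1 f l‖) ^ 2 := by
    intro l
    rw [mul_comm 2 a, Real.rpow_mul (by positivity), Real.rpow_two]
    ring
  have main := hschur (fun ξ => (B * D) * ((1 + |ξ|) ^ s * ‖FT1 φ ξ‖))
    (fun l => (1 + |l|) ^ a * ‖FT1 f l‖) (by fun_prop) (fun _ => by positivity)
    (fun _ => by positivity)
    (by simp_rw [hG2]; exact (FT1_integrable_sq φ s).const_mul _) ?_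
  · simp_rw [hG2] at main
    simp_rw [hF2]
    rw [integral_const_mul] at main
    linarith
  · intro l
    have e1 : ‖FT1 f l‖ ≤ ‖∫ ξ : ℝ, Complex.exp (Complex.I * ξ * x) *
      ((Complex.I * ξ) ^ j * FT1 φ ξ) * FT1 ψ (l - om β ξ)‖ := by
      rw [hf, FT1_time, norm_mul]
      refine mul_le_of_le_one_left (norm_nonneg _) ?_
      rw [norm_div, norm_mul, Complex.norm_real, Real.norm_of_nonneg Real.pi_pos.le]
      simp only [norm_one, Complex.norm_ofNat]
      rw [div_le_one (by positivity)]
      linarith [Real.pi_gt_three]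
    calc ENNReal.ofReal ((1 + |l|) ^ a * ‖FT1 f l‖)
        ≤ ENNReal.ofReal ((1 + |l|) ^ a * ‖∫ ξ : ℝ, Complex.exp (Complex.I * ξ * x) *
      ((Complex.I * ξ) ^ j * FT1 φ ξ) * FT1 ψ (l - om β ξ)‖) := by gcongr
      _ = ENNReal.ofReal ((1 + |l|) ^ a) * ‖∫ ξ : ℝ, Complex.exp (Complex.I * ξ * x) *
      ((Complex.I * ξ) ^ j * FT1 φ ξ) * FT1 ψ (l - om β ξ)‖ₑ := by
          rw [ENNReal.ofReal_mul (by positivity), ofReal_norm]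
      _ ≤ ENNReal.ofReal ((1 + |l|) ^ a) * ∫⁻ ξ : ℝ, ‖Complex.exp (Complex.I * ξ * x) *
      ((Complex.I * ξ) ^ j * FT1 φ ξ) * FT1 ψ (l - om β ξ)‖ₑ := by
          gcongr; exact enorm_integral_le_lintegral_enorm _
      _ = ∫⁻ ξ : ℝ, ENNReal.ofReal ((1 + |l|) ^ a) * ‖Complex.exp (Complex.I * ξ * x) *
      ((Complex.I * ξ) ^ j * FT1 φ ξ) * FT1 ψ (l - om β ξ)‖ₑ :=
          (lintegral_const_mul' _ _ ENNReal.ofReal_ne_top).symm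
      _ ≤ _ := by
          refine lintegral_mono fun ξ => ?_
          rw [← ofReal_norm, ← ENNReal.ofReal_mul (by positivity)]
          apply ENNReal.ofReal_le_ofReal
          have e2 : ‖Complex.exp (Complex.I * ξ * x)‖ = 1 := by
            have := exp_norm 0 0 x ξ
            simpa using this
          rw [norm_mul, norm_mul, e2, one_mul, norm_mul, norm_pow, norm_mul, Complex.norm_I,
            one_mul, Complex.norm_real, Real.norm_eq_abs]
          have e3 := wt_bound β a l ξ
          have e4 := hdec (l - om β ξ)
          have e5 : |ξ| ^ j ≤ (1 + |ξ|) ^ (j : ℝ) := by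
            rw [Real.rpow_natCast]; gcongr; linarith
          have e6 : (1 + |ξ|) ^ (3 * a) * (1 + |ξ|) ^ (j : ℝ) = (1 + |ξ|) * (1 + |ξ|) ^ s := by
            rw [← Real.rpow_add (by positivity), ← Real.rpow_one_add' (by positivity) (by linarith)]
            congr 1
            rw [ha]; ring
          calc (1 + |l|) ^ a * (|ξ| ^ j * ‖FT1 φ ξ‖ * ‖FT1 ψ (l - om β ξ)‖)
              ≤ (B * (1 + |l - om β ξ|) ^ |a| * (1 + |ξ|) ^ (3 * a)) *
                ((1 + |ξ|) ^ (j : ℝ) * ‖FT1 φ ξ‖ * ‖FT1 ψ (l - om β ξ)‖) := by gcongr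
            _ = B * ((1 + |ξ|) ^ (3 * a) * (1 + |ξ|) ^ (j : ℝ)) * ‖FT1 φ ξ‖ *
                ((1 + |l - om β ξ|) ^ |a| * ‖FT1 ψ (l - om β ξ)‖) := by ring
            _ ≤ B * ((1 + |ξ|) ^ (3 * a) * (1 + |ξ|) ^ (j : ℝ)) * ‖FT1 φ ξ‖ *
                (D * (1 + (l - om β ξ) ^ 2)⁻¹) := by gcongr
            _ = _ := by rw [e6]; ring

theorem FT2_bound (β τ ξ : ℝ) (ψ φ : SchwartzMap ℝ ℂ) :
    ‖FT2 (fun q => ψ q.1 * airy β q.1 φ q.2) τ ξ‖ ≤ ‖FT1 ψ (τ - om β ξ)‖ * ‖FT1 φ ξ‖ := by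
  unfold FT2
  by_cases hi : Integrable (fun q : ℝ × ℝ => Complex.exp (-(Complex.I * (q.1 * τ + q.2 * ξ))) *
      (ψ q.1 * airy β q.1 φ q.2))
  swap
  · rw [integral_undef hi, norm_zero]; positivity
  rw [Measure.volume_eq_prod] at hi ⊢
  rw [integral_prod _ hi]
  have h1 : ∀ᵐ t : ℝ, (∫ x : ℝ, Complex.exp (-(Complex.I * (t * τ + x * ξ))) *
      (ψ t * airy β t φ x)) =
      (Complex.exp (-(Complex.I * ((τ - om β ξ : ℝ) : ℂ) * t)) * ψ t) * FT1 φ ξ := by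
    filter_upwards [hi.prod_right_ae] with t ht
    have h2 : ∀ x : ℝ, Complex.exp (-(Complex.I * (t * τ + x * ξ))) * (ψ t * airy β t φ x) =
        (Complex.exp (-(Complex.I * t * τ)) * ψ t) *
          (Complex.exp (-(Complex.I * ξ * x)) * airy β t φ x) := by
      intro x
      have : Complex.exp (-(Complex.I * (t * τ + x * ξ))) = Complex.exp (-(Complex.I * t * τ)) *
          Complex.exp (-(Complex.I * ξ * x)) := by
        rw [← Complex.exp_add]; congr 1; ring
      rw [this]; ring
    simp only [h2] at ht ⊢
    by_cases h0 : ψ t = 0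
    · simp [h0]
    have hne : Complex.exp (-(Complex.I * t * τ)) * ψ t ≠ 0 := mul_ne_zero (Complex.exp_ne_zero _) h0
    have h3 : Integrable (fun x : ℝ => Complex.exp (-(Complex.I * ξ * x)) * airy β t φ x) :=
      (integrable_const_mul_iff (IsUnit.mk0 _ hne) _).1 ht
    rw [integral_const_mul]
    by_cases h4 : Integrable (airy β t φ)
    · have h5 := airy_FT β t φ h4 ξ
      unfold FT1 at h5 ⊢
      rw [h5]
      have h6 : Complex.exp (-(Complex.I * ((τ - om β ξ : ℝ) : ℂ) * t)) =
        Complex.exp (-(Complex.I * t * τ)) * Complex.exp (Complex.I * t * ((ξ : ℂ)^3 - β * ξ)) := by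
        rw [← Complex.exp_add]; congr 1; unfold om; push_cast; ring
      rw [h6]; ring
    · exfalso
      apply h4
      have hc : Continuous fun x : ℝ => Complex.exp (Complex.I * ξ * x) := by fun_prop
      have h7 := h3.bdd_mul (c := 1) hc.aestronglyMeasurable (ae_of_all _ fun x => by
        have := exp_norm'' (-ξ) x
        simp only [Complex.ofReal_neg, mul_neg, neg_mul, neg_neg] at this
        exact this.le)
      refine h7.congr (ae_of_all _ fun x => ?_)
      simp only
      rw [← mul_assoc, ← Complex.exp_add]
      simp
  rw [integral_congr_ae h1, integral_mul_const, norm_mul]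
  exact le_rfl

set_option maxHeartbeats 1000000 in
theorem part3 (s b σ β : ℝ) (hs : 0 ≤ s) (hb : b ∈ Set.Ioo (0:ℝ) (1/2))
    (hσ : σ ∈ Set.Ioo (1/2 : ℝ) (2/3)) (ψ : SchwartzMap ℝ ℂ) :
    ∃ C, 0 ≤ C ∧ ∀ φ : SchwartzMap ℝ ℂ,
      XNorm s b β σ (fun q => ψ q.1 * airy β q.1 φ q.2) ≤ C * sobNorm s φ := by
  obtain ⟨D, hD, hdec⟩ := FT1_decay_rpow ψ (s + 1)
  set B : ℝ := 8 * (1 + |β|) ^ 3 with hB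
  have hB1 : 1 ≤ B := by
    have : 1 ≤ (1 + |β|) ^ 3 := one_le_pow₀ (by linarith [abs_nonneg β])
    linarith
  set A : ℝ := ((1 + B) ^ s * (1 + 8 * B) * D) ^ 2 with hA
  refine ⟨Real.sqrt (A * Real.pi * (2 * Real.pi)), by positivity, fun φ => ?_⟩
  have hcg := FT1_continuous φ
  have hom := om_cont β
  have hGi := FT1_integrable_sq φ s
  have hcw := cont_wt (2 * s)
  have hE : 0 ≤ ∫ ξ : ℝ, (1 + |ξ|) ^ (2 * s) * ‖FT1 φ ξ‖ ^ 2 :=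
    integral_nonneg fun _ => by positivity
  unfold XNorm sobNorm
  rw [← Real.sqrt_mul (by positivity)]
  apply Real.sqrt_le_sqrt
  have hrw : A * Real.pi * (2 * Real.pi) *
      ((1 / (2 * Real.pi)) * ∫ ξ : ℝ, (1 + |ξ|) ^ (2 * s) * ‖FT1 φ ξ‖ ^ 2) =
      A * Real.pi * ∫ ξ : ℝ, (1 + |ξ|) ^ (2 * s) * ‖FT1 φ ξ‖ ^ 2 := by
    field_simp
  rw [hrw]
  have hnu : ∀ τ ξ, 0 ≤ nuWt b σ β τ ξ := by
    intro τ ξ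
    unfold nuWt
    have : 0 ≤ Set.indicator (Set.Icc (-1:ℝ) 1) (fun _ => (1:ℝ)) ξ :=
      Set.indicator_nonneg (fun _ _ => zero_le_one) _
    positivity
  refine integral_le_of_lintegral _ (fun q => by positivity) (by positivity) ?_
  -- pointwise bound
  have hpt : ∀ τ ξ : ℝ, (1 + |ξ| + |τ| ^ ((1:ℝ)/3)) ^ (2 * s) * (nuWt b σ β τ ξ)^2 *
      ‖FT2 (fun q => ψ q.1 * airy β q.1 φ q.2) τ ξ‖^2 ≤
      A * ((1 + (τ - om β ξ) ^ 2)⁻¹ * ((1 + |ξ|) ^ (2 * s) * ‖FT1 φ ξ‖ ^ 2)) := by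
    intro τ ξ
    set m : ℝ := 1 + |τ - om β ξ| with hm
    have hm1 : 1 ≤ m := by linarith [abs_nonneg (τ - om β ξ)]
    have hx1 : 1 ≤ 1 + |ξ| := by linarith [abs_nonneg ξ]
    have hp1 : 1 + |τ| ≤ m * (1 + |om β ξ|) := peetre τ (om β ξ)
    have hp2 : 1 + |om β ξ| ≤ B * (1 + |ξ|) ^ 3 := om_up β ξ
    have hw1 : |τ| ^ ((1:ℝ)/3) ≤ B * m * (1 + |ξ|) := by
      have h1 : |τ| ≤ (B * m * (1 + |ξ|)) ^ 3 := by
        have h2 : |τ| ≤ m * (B * (1 + |ξ|) ^ 3) := by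
          have : m * (1 + |om β ξ|) ≤ m * (B * (1 + |ξ|) ^ 3) := by gcongr
          linarith
        have h3 : B * m ≤ (B * m) ^ 3 := le_self_pow₀ (one_le_mul_of_one_le_of_one_le hB1 hm1) (by norm_num)
        calc |τ| ≤ (B * m) * (1 + |ξ|) ^ 3 := by linarith
          _ ≤ (B * m) ^ 3 * (1 + |ξ|) ^ 3 := by gcongr
          _ = _ := by ring
      calc |τ| ^ ((1:ℝ)/3) ≤ ((B * m * (1 + |ξ|)) ^ 3) ^ ((1:ℝ)/3) := by gcongr
        _ = _ := by
          rw [← Real.rpow_natCast, ← Real.rpow_mul (by positivity)]; norm_num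
    have hw2 : 1 + |ξ| + |τ| ^ ((1:ℝ)/3) ≤ (1 + B) * m * (1 + |ξ|) := by
      have : 1 * (1 + |ξ|) ≤ m * (1 + |ξ|) := by gcongr
      linarith
    have hw3 : (1 + |ξ| + |τ| ^ ((1:ℝ)/3)) ^ s ≤ (1 + B) ^ s * m ^ s * (1 + |ξ|) ^ s := by
      rw [← Real.mul_rpow (by positivity) (by positivity),
        ← Real.mul_rpow (by positivity) (by positivity)]
      gcongr
    have hν : nuWt b σ β τ ξ ≤ (1 + 8 * B) * m := by
      unfold nuWt
      have e1 : τ - ξ ^ 3 + β * ξ = τ - om β ξ := by unfold om; ring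
      rw [e1, ← hm]
      have e2 : m ^ b ≤ m := by
        calc m ^ b ≤ m ^ (1:ℝ) := by
              apply Real.rpow_le_rpow_of_exponent_le hm1; linarith [hb.2]
          _ = m := Real.rpow_one m
      have e3 : Set.indicator (Set.Icc (-1:ℝ) 1) (fun _ => (1:ℝ)) ξ * (1 + |τ|) ^ σ ≤ 8 * B * m := by
        by_cases hξ : ξ ∈ Set.Icc (-1:ℝ) 1
        · rw [Set.indicator_of_mem hξ, one_mul]
          have hξ1 : |ξ| ≤ 1 := abs_le.2 hξ
          have ht : 1 ≤ 1 + |τ| := by linarith [abs_nonneg τ]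
          calc (1 + |τ|) ^ σ ≤ (1 + |τ|) ^ (1:ℝ) := by
                apply Real.rpow_le_rpow_of_exponent_le ht; linarith [hσ.2]
            _ = 1 + |τ| := Real.rpow_one _
            _ ≤ m * (B * (1 + |ξ|) ^ 3) := hp1.trans (by gcongr)
            _ ≤ m * (B * (1 + 1) ^ 3) := by gcongr
            _ = _ := by ring
        · rw [Set.indicator_of_notMem hξ, zero_mul]; positivity
      linarith
    have hF := FT2_bound β τ ξ ψ φ
    have hd := hdec (τ - om β ξ)
    rw [← hm, Real.rpow_add (by linarith), Real.rpow_one] at hd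
    have hJ : (1 + (τ - om β ξ) ^ 2)⁻¹ ≤ 1 :=
      inv_le_one_of_one_le₀ (by nlinarith [sq_nonneg (τ - om β ξ)])
    set J := (1 + (τ - om β ξ) ^ 2)⁻¹ with hJd
    have hJ0 : 0 ≤ J := by positivity
    have hn := hnu τ ξ
    have hprod : (1 + |ξ| + |τ| ^ ((1:ℝ)/3)) ^ s * nuWt b σ β τ ξ *
      ‖FT2 (fun q => ψ q.1 * airy β q.1 φ q.2) τ ξ‖ ≤
      ((1 + B) ^ s * (1 + 8 * B) * D) * J * ((1 + |ξ|) ^ s * ‖FT1 φ ξ‖) := by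
      calc _ ≤ ((1 + B) ^ s * m ^ s * (1 + |ξ|) ^ s) * ((1 + 8 * B) * m) *
            (‖FT1 ψ (τ - om β ξ)‖ * ‖FT1 φ ξ‖) := by gcongr
        _ = ((1 + B) ^ s * (1 + 8 * B)) * (m ^ s * m * ‖FT1 ψ (τ - om β ξ)‖) *
            ((1 + |ξ|) ^ s * ‖FT1 φ ξ‖) := by ring
        _ ≤ ((1 + B) ^ s * (1 + 8 * B)) * (D * J) * ((1 + |ξ|) ^ s * ‖FT1 φ ξ‖) := by gcongr
        _ = _ := by ring
    have hsq := pow_le_pow_left₀ (by positivity) hprod 2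
    have hJJ : J ^ 2 ≤ J := by nlinarith
    have r1 : (1 + |ξ|) ^ (2 * s) = ((1 + |ξ|) ^ s) ^ 2 := by
      rw [mul_comm 2 s, Real.rpow_mul (by positivity), Real.rpow_two]
    have r2 : (1 + |ξ| + |τ| ^ ((1:ℝ)/3)) ^ (2 * s) = ((1 + |ξ| + |τ| ^ ((1:ℝ)/3)) ^ s) ^ 2 := by
      rw [mul_comm 2 s, Real.rpow_mul (by positivity), Real.rpow_two]
    rw [r1, r2]
    calc _ = ((1 + |ξ| + |τ| ^ ((1:ℝ)/3)) ^ s * nuWt b σ β τ ξ *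
      ‖FT2 (fun q => ψ q.1 * airy β q.1 φ q.2) τ ξ‖) ^ 2 := by ring
      _ ≤ _ := hsq
      _ = A * (J ^ 2 * (((1 + |ξ|) ^ s) ^ 2 * ‖FT1 φ ξ‖ ^ 2)) := by rw [hA]; ring
      _ ≤ _ := by gcongr
  have hJ2 : Continuous fun p : ℝ × ℝ => (1 + (p.1 - om β p.2) ^ 2)⁻¹ :=
      Continuous.inv₀ (by fun_prop) (fun p => by positivity)
  set G2 : ℝ → ℝ := fun ξ => (1 + |ξ|) ^ (2 * s) * ‖FT1 φ ξ‖ ^ 2 with hG2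
  have hG2c : Continuous G2 := by fun_prop
  have hG20 : ∀ ξ, 0 ≤ G2 ξ := fun ξ => by positivity
  have hmeas : Measurable fun q : ℝ × ℝ => ENNReal.ofReal ((1 + (q.1 - om β q.2) ^ 2)⁻¹ * G2 q.2) :=
    ENNReal.measurable_ofReal.comp (Continuous.measurable (by fun_prop))
  calc _ ≤ ∫⁻ q : ℝ × ℝ, ENNReal.ofReal A *
          ENNReal.ofReal ((1 + (q.1 - om β q.2) ^ 2)⁻¹ * G2 q.2) := by
        refine lintegral_mono fun q => ?_
        rw [← ENNReal.ofReal_mul (by positivity)]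
        exact ENNReal.ofReal_le_ofReal (hpt q.1 q.2)
    _ = ENNReal.ofReal A * ∫⁻ q : ℝ × ℝ,
          ENNReal.ofReal ((1 + (q.1 - om β q.2) ^ 2)⁻¹ * G2 q.2) :=
        lintegral_const_mul' _ _ ENNReal.ofReal_ne_top
    _ = ENNReal.ofReal A * ∫⁻ ξ : ℝ, ∫⁻ τ : ℝ,
          ENNReal.ofReal ((1 + (τ - om β ξ) ^ 2)⁻¹ * G2 ξ) := by
        rw [Measure.volume_eq_prod, lintegral_prod_symm' _ hmeas]
    _ = ENNReal.ofReal A * ∫⁻ ξ, ENNReal.ofReal Real.pi * ENNReal.ofReal (G2 ξ) := by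
        congr 2
        ext ξ
        simp_rw [ENNReal.ofReal_mul (inv_nonneg.2 (add_nonneg zero_le_one (sq_nonneg _)))]
        rw [lintegral_mul_const' _ _ ENNReal.ofReal_ne_top,
          lintegral_sub_right_eq_self (fun m : ℝ => ENNReal.ofReal ((1 + m ^ 2)⁻¹)) (om β ξ), lint_J]
    _ = ENNReal.ofReal (A * Real.pi * ∫ ξ, G2 ξ) := by
        rw [lintegral_const_mul' _ _ ENNReal.ofReal_ne_top,
          ← ofReal_integral_eq_lintegral_ofReal hGi (ae_of_all _ hG20),
          ← ENNReal.ofReal_mul (by positivity), ← ENNReal.ofReal_mul (by positivity), mul_assoc]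

/-- Group estimates for the Airy group (Lemma 2.2, after Faminskii). -/
theorem airy_group_estimates (s b σ β : ℝ) (hs : 0 ≤ s)
    (hb : b ∈ Set.Ioo (0:ℝ) (1/2)) (hσ : σ ∈ Set.Ioo (1/2 : ℝ) (2/3))
    (ψ : ℝ → ℝ) (hψsmooth : ContDiff ℝ (⊤ : ℕ∞) ψ)
    (hψsupp : Function.support ψ ⊆ Set.Icc (-2) 2)
    (hψone : ∀ t ∈ Set.Icc (-1:ℝ) 1, ψ t = 1) :
    ∃ C > 0, ∀ φ : SchwartzMap ℝ ℂ,
      (⨆ t : ℝ, sobNorm s (fun x => (ψ t : ℂ) * airy β t (⇑φ) x)) +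
      (∑ j ∈ Finset.range 3, ⨆ x : ℝ,
        sobNorm ((s + 1 - j) / 3)
          (fun t => (ψ t : ℂ) * iteratedDeriv j (fun y => airy β t (⇑φ) y) x)) +
      XNorm s b β σ (fun q => (ψ q.1 : ℂ) * airy β q.1 (⇑φ) q.2)
        ≤ C * sobNorm s (⇑φ) := by
  have hcs : HasCompactSupport (fun t => (ψ t : ℂ)) := by
    refine HasCompactSupport.of_support_subset_isCompact (isCompact_Icc (a := (-2:ℝ)) (b := 2)) ?_
    intro t ht
    apply hψsupp
    simpa using ht
  have hsm : ContDiff ℝ (⊤ : ℕ∞) (fun t => (ψ t : ℂ)) := Complex.ofRealCLM.contDiff.comp hψsmooth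
  let ψS : SchwartzMap ℝ ℂ := hcs.toSchwartzMap hsm
  have hψS : ∀ t, ψS t = (ψ t : ℂ) := fun t => rfl
  obtain ⟨M, hM⟩ : ∃ M, ∀ t, |ψ t| ≤ M := by
    obtain ⟨M, hM⟩ := hcs.exists_bound_of_continuous hsm.continuous
    exact ⟨M, fun t => by simpa using hM t⟩
  choose C2 hC20 hC2 using part2 s β hs ψS
  obtain ⟨C3, hC30, hC3⟩ := part3 s b σ β hs hb hσ ψS
  refine ⟨Real.sqrt (M ^ 2) + (∑ j ∈ Finset.range 3, C2 j) + C3 + 1, ?_, fun φ => ?_⟩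
  · have : 0 ≤ ∑ j ∈ Finset.range 3, C2 j := Finset.sum_nonneg fun j _ => hC20 j
    positivity
  have h0 := sobNorm_nonneg s φ
  have h1 := ciSup_le (part1 s β M ψ hM φ)
  have h2 : (∑ j ∈ Finset.range 3, ⨆ x : ℝ,
        sobNorm ((s + 1 - j) / 3)
          (fun t => (ψ t : ℂ) * iteratedDeriv j (fun y => airy β t (⇑φ) y) x)) ≤
      ∑ j ∈ Finset.range 3, C2 j * sobNorm s φ :=
    Finset.sum_le_sum fun j _ => ciSup_le (hC2 j φ)
  have h3 := hC3 φ
  rw [← Finset.sum_mul] at h2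
  calc _ ≤ Real.sqrt (M ^ 2) * sobNorm s φ + (∑ j ∈ Finset.range 3, C2 j) * sobNorm s φ +
        C3 * sobNorm s φ := add_le_add (add_le_add h1 h2) h3
    _ ≤ _ := by linarith
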